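/- arXiv:2004.06975 — 2 statements merged into one kernel-verified Lean document; each statement's English description precedes it below -/
import Mathlib

section
/- Fix α_u, α_v, ρ_u, ρ_v > 0 and define i(m_u,m_v,λ) = (λ α_u α_v/2)(ρ_u−m_u)(ρ_v−m_v) + (α_u/2) ln(1+λ α_v ρ_u m_v) + (α_v/2) ln(1+λ α_u ρ_v m_u) on [0,ρ_u]×[0,ρ_v]×(0,∞). For every (m_u,λ) ∈ [0,ρ_u]×(0,∞) there exists a unique m_v*(m_u,λ) ∈ [0,ρ_v] such that i(m_u, m_v*(m_u,λ), λ) = sup_{m_v∈[0,ρ_v]} i(m_u,m_v,λ). Moreover, setting m̄_u(λ) = ρ_u (1 − 1/(1+λ α_v ρ_u ρ_v)), one has m_v*(m_u,λ) = m_u/(λ α_v ρ_u (ρ_u − m_u)) if 0 ≤ m_u ≤ m̄_u(λ), and m_v*(m_u,λ) = ρ_v if m̄_u(λ) < m_u ≤ ρ_u; the function m_v* is continuous on [0,ρ_u]×(0,∞), and for all λ > 0 and m_u ∈ [0, m̄_u(λ)] the partial derivative ∂i/∂m_v vanishes at (m_u, m_v*(m_u,λ), λ). -/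
open Real Set

noncomputable section

/-- The replica-symmetric potential `i(m_u, m_v, λ)`. -/
def rsPotential (au av ru rv mu mv lam : ℝ) : ℝ :=
  lam * au * av / 2 * (ru - mu) * (rv - mv)
    + au * Real.log (1 + lam * av * ru * mv) / 2
    + av * Real.log (1 + lam * au * rv * mu) / 2

/-- `m̄_u(λ) = ρ_u(1 − 1/(1 + λα_vρ_uρ_v))`. -/
def muBar (au av ru rv lam : ℝ) : ℝ := ru * (1 - 1 / (1 + lam * av * ru * rv))

/-- The maximizer `m_v^*(m_u, λ)` of `m_v ↦ i(m_u, m_v, λ)` over `[0, ρ_v]`. -/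
def mvArgmax (au av ru rv mu lam : ℝ) : ℝ :=
  if mu ≤ muBar au av ru rv lam then mu / (lam * av * ru * (ru - mu)) else rv

/-- The maximizer in a form that is manifestly continuous in `(m_u, λ)`. -/
lemma mvArgmax_eq_div_max {av ru rv lam : ℝ} (au mu : ℝ) (hav : 0 < av) (hru : 0 < ru)
    (hrv : 0 < rv) (hlam : 0 < lam) :
    mvArgmax au av ru rv mu lam
      = (ru / max (ru - mu) (ru / (1 + lam * av * ru * rv)) - 1) / (lam * av * ru) := by
  have hc : 0 < lam * av * ru := by positivity
  have hK : 0 < 1 + lam * av * ru * rv := by positivity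
  have hq : 0 < ru / (1 + lam * av * ru * rv) := by positivity
  have hbar : muBar au av ru rv lam = ru - ru / (1 + lam * av * ru * rv) := by
    unfold muBar; ring
  unfold mvArgmax
  rw [hbar]
  split_ifs with h
  · rw [max_eq_left (by linarith)]
    have h1 : 0 < ru - mu := by linarith
    field_simp
    ring
  · rw [max_eq_right (by linarith)]
    field_simp
    ring

lemma one_add_mul_mvArgmax {av ru rv lam : ℝ} (au mu : ℝ) (hav : 0 < av) (hru : 0 < ru)
    (hrv : 0 < rv) (hlam : 0 < lam) :
    1 + lam * av * ru * mvArgmax au av ru rv mu lam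
      = ru / max (ru - mu) (ru / (1 + lam * av * ru * rv)) := by
  have hc : 0 < lam * av * ru := by positivity
  rw [mvArgmax_eq_div_max au mu hav hru hrv hlam, mul_div_cancel₀ _ hc.ne']
  ring

lemma mvArgmax_mem_Icc {av ru rv lam mu : ℝ} (au : ℝ) (hav : 0 < av) (hru : 0 < ru)
    (hrv : 0 < rv) (hlam : 0 < lam) (hmu : 0 ≤ mu) :
    mvArgmax au av ru rv mu lam ∈ Icc (0 : ℝ) rv := by
  have hc : 0 < lam * av * ru := by positivity
  have hK : 1 ≤ 1 + lam * av * ru * rv := by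
    have : 0 < lam * av * ru * rv := by positivity
    linarith
  have hq : 0 < ru / (1 + lam * av * ru * rv) := by positivity
  have hD : 0 < max (ru - mu) (ru / (1 + lam * av * ru * rv)) := lt_max_of_lt_right hq
  have hM := one_add_mul_mvArgmax au mu hav hru hrv hlam
  have hlow : 1 ≤ ru / max (ru - mu) (ru / (1 + lam * av * ru * rv)) := by
    rw [le_div_iff₀ hD, one_mul]
    exact max_le (by linarith) (div_le_self hru.le hK)
  have hupp : ru / max (ru - mu) (ru / (1 + lam * av * ru * rv)) ≤ 1 + lam * av * ru * rv := by
    rw [div_le_comm₀ hD (by linarith)]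
    exact le_max_right _ _
  rw [← hM] at hlow hupp
  exact ⟨nonneg_of_mul_nonneg_right (by linarith) hc,
    le_of_mul_le_mul_left (by linarith) hc⟩

lemma rsPotential_lt_mvArgmax {au av ru rv lam mu mv : ℝ} (hau : 0 < au) (hav : 0 < av)
    (hru : 0 < ru) (hrv : 0 < rv) (hlam : 0 < lam) (hmu : 0 ≤ mu) (hmv : mv ∈ Icc (0 : ℝ) rv)
    (hne : mv ≠ mvArgmax au av ru rv mu lam) :
    rsPotential au av ru rv mu mv lam
      < rsPotential au av ru rv mu (mvArgmax au av ru rv mu lam) lam := by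
  have hM := one_add_mul_mvArgmax au mu hav hru hrv hlam
  have hm := (mvArgmax_mem_Icc au hav hru hrv hlam hmu).1
  have hfirst : (mv - mvArgmax au av ru rv mu lam)
      * (max (ru - mu) (ru / (1 + lam * av * ru * rv)) - (ru - mu)) ≤ 0 := by
    by_cases h : mu ≤ muBar au av ru rv lam
    · have hbar : muBar au av ru rv lam = ru - ru / (1 + lam * av * ru * rv) := by
        unfold muBar; ring
      rw [max_eq_left (by linarith)]
      simp
    · have hrv' : mvArgmax au av ru rv mu lam = rv := if_neg h
      rw [hrv']
      exact mul_nonpos_of_nonpos_of_nonneg (by linarith [hmv.2])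
        (by linarith [le_max_left (ru - mu) (ru / (1 + lam * av * ru * rv))])
  have hD : 0 < max (ru - mu) (ru / (1 + lam * av * ru * rv)) :=
    lt_max_of_lt_right (by positivity)
  generalize max (ru - mu) (ru / (1 + lam * av * ru * rv)) = D at hM hfirst hD
  generalize mvArgmax au av ru rv mu lam = m at *
  have hX : 0 < 1 + lam * av * ru * mv := by have := hmv.1; positivity
  have hMpos : 0 < 1 + lam * av * ru * m := by positivity
  have hc : lam * av * ru ≠ 0 := by positivity
  have hlog := Real.log_lt_sub_one_of_pos (div_pos hX hMpos) (by
    rw [Ne, div_eq_one_iff_eq hMpos.ne']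
    intro h
    exact hne (mul_left_cancel₀ hc (by linarith)))
  rw [Real.log_div hX.ne' hMpos.ne'] at hlog
  have hratio : (1 + lam * av * ru * mv) / (1 + lam * av * ru * m) - 1
      = lam * av * (mv - m) * D := by
    have hDM : D * (1 + lam * av * ru * m) = ru := by rw [hM, mul_div_cancel₀ _ hD.ne']
    rw [div_sub_one hMpos.ne', div_eq_iff hMpos.ne']
    linear_combination (-(lam * av * (mv - m))) * hDM
  rw [hratio] at hlog
  have hlog' := mul_lt_mul_of_pos_left hlog hau
  have hfirst' := mul_le_mul_of_nonneg_left hfirst (by positivity : 0 ≤ lam * au * av)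
  unfold rsPotential
  linarith

lemma continuousOn_mvArgmax {av ru rv : ℝ} (au : ℝ) (hav : 0 < av) (hru : 0 < ru)
    (hrv : 0 < rv) :
    ContinuousOn (fun p : ℝ × ℝ => mvArgmax au av ru rv p.1 p.2) (univ ×ˢ Ioi (0 : ℝ)) := by
  have hform : ContinuousOn (fun p : ℝ × ℝ =>
      (ru / max (ru - p.1) (ru / (1 + p.2 * av * ru * rv)) - 1) / (p.2 * av * ru))
      (univ ×ˢ Ioi (0 : ℝ)) := by
    have hK : ∀ p ∈ (univ : Set ℝ) ×ˢ Ioi (0 : ℝ), 0 < 1 + p.2 * av * ru * rv := by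
      rintro p ⟨-, hp⟩
      have : 0 < p.2 := hp
      positivity
    refine ContinuousOn.div (ContinuousOn.sub (ContinuousOn.div continuousOn_const
      (ContinuousOn.sup (by fun_prop) (ContinuousOn.div continuousOn_const (by fun_prop)
        fun p hp => (hK p hp).ne')) fun p hp => ?_) continuousOn_const) (by fun_prop)
      fun p hp => ?_
    · exact (lt_max_of_lt_right (div_pos hru (hK p hp))).ne'
    · have : 0 < p.2 := hp.2
      positivity
  exact hform.congr fun p hp => mvArgmax_eq_div_max au p.1 hav hru hrv hp.2

lemma hasDerivAt_rsPotential {au av ru rv mu mv lam : ℝ} (h : 1 + lam * av * ru * mv ≠ 0) :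
    HasDerivAt (fun x => rsPotential au av ru rv mu x lam)
      (lam * au * av / 2 * (ru / (1 + lam * av * ru * mv) - (ru - mu))) mv := by
  have hlin : HasDerivAt (fun x : ℝ => 1 + lam * av * ru * x) (lam * av * ru) mv := by
    simpa using ((hasDerivAt_id mv).const_mul (lam * av * ru)).const_add 1
  have hsub : HasDerivAt (fun x : ℝ => rv - x) (-1) mv := (hasDerivAt_id mv).const_sub rv
  have := (((hsub.const_mul (lam * au * av / 2 * (ru - mu))).add
    (((hlin.log h).const_mul au).div_const 2)).add_const
      (av * Real.log (1 + lam * au * rv * mu) / 2))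
  refine this.congr_deriv ?_
  ring

/-- **Lemma on `m_v^*`.** For fixed `α_u, α_v, ρ_u, ρ_v > 0`,
for every `(m_u, λ) ∈ [0,ρ_u] × (0,∞)` the point `m_v^*(m_u,λ)` (given by the
explicit piecewise formula) is the unique point of `[0,ρ_v]` at which
`m_v ↦ i(m_u,m_v,λ)` attains its supremum over `[0,ρ_v]`; moreover `m_v^*` is
continuous on `[0,ρ_u] × (0,∞)` and `∂i/∂m_v` vanishes at
`(m_u, m_v^*(m_u,λ), λ)` whenever `m_u ∈ [0, m̄_u(λ)]`. -/
theorem mv_argmax_properties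
    (au av ru rv : ℝ) (hau : 0 < au) (hav : 0 < av) (hru : 0 < ru) (hrv : 0 < rv) :
    (∀ lam : ℝ, 0 < lam → ∀ mu ∈ Icc (0:ℝ) ru,
      mvArgmax au av ru rv mu lam ∈ Icc (0:ℝ) rv ∧
      (∀ mv ∈ Icc (0:ℝ) rv,
        rsPotential au av ru rv mu mv lam
          ≤ rsPotential au av ru rv mu (mvArgmax au av ru rv mu lam) lam) ∧
      (∀ mv ∈ Icc (0:ℝ) rv,
        rsPotential au av ru rv mu mv lam
            = rsPotential au av ru rv mu (mvArgmax au av ru rv mu lam) lam →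
          mv = mvArgmax au av ru rv mu lam) ∧
      rsPotential au av ru rv mu (mvArgmax au av ru rv mu lam) lam
        = sSup ((fun mv => rsPotential au av ru rv mu mv lam) '' Icc (0:ℝ) rv)) ∧
    ContinuousOn (fun p : ℝ × ℝ => mvArgmax au av ru rv p.1 p.2)
      (Icc (0:ℝ) ru ×ˢ Ioi (0:ℝ)) ∧
    (∀ lam : ℝ, 0 < lam → ∀ mu ∈ Icc (0:ℝ) (muBar au av ru rv lam),
      HasDerivAt (fun mv => rsPotential au av ru rv mu mv lam) 0
        (mvArgmax au av ru rv mu lam)) := by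
  refine ⟨fun lam hlam mu hmu => ?_, ?_, fun lam hlam mu hmu => ?_⟩
  · have hmem := mvArgmax_mem_Icc au hav hru hrv hlam hmu.1
    have hlt : ∀ mv ∈ Icc (0:ℝ) rv, mv ≠ mvArgmax au av ru rv mu lam → _ := fun mv hmv =>
      rsPotential_lt_mvArgmax hau hav hru hrv hlam hmu.1 hmv
    have hle : ∀ mv ∈ Icc (0:ℝ) rv, rsPotential au av ru rv mu mv lam
        ≤ rsPotential au av ru rv mu (mvArgmax au av ru rv mu lam) lam := by
      intro mv hmv
      rcases eq_or_ne mv (mvArgmax au av ru rv mu lam) with h | h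
      · rw [h]
      · exact (hlt mv hmv h).le
    refine ⟨hmem, hle, fun mv hmv heq => ?_, ?_⟩
    · by_contra h
      exact (hlt mv hmv h).ne heq
    · have hgreatest : IsGreatest ((fun mv => rsPotential au av ru rv mu mv lam) '' Icc (0:ℝ) rv)
          (rsPotential au av ru rv mu (mvArgmax au av ru rv mu lam) lam) :=
        ⟨mem_image_of_mem _ hmem, forall_mem_image.2 hle⟩
      exact hgreatest.csSup_eq.symm
  · exact (continuousOn_mvArgmax au hav hru hrv).mono (prod_mono_left (subset_univ _))
  · have hM := one_add_mul_mvArgmax au mu hav hru hrv hlam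
    have hq : 0 < ru / (1 + lam * av * ru * rv) := by positivity
    have hbar : muBar au av ru rv lam = ru - ru / (1 + lam * av * ru * rv) := by
      unfold muBar; ring
    have hmu' := hmu.2
    rw [max_eq_left (by linarith)] at hM
    have hpos : 0 < ru - mu := by linarith
    have hne : 1 + lam * av * ru * mvArgmax au av ru rv mu lam ≠ 0 := by
      rw [hM]; positivity
    refine (hasDerivAt_rsPotential hne).congr_deriv ?_
    rw [hM, div_div_cancel₀ hru.ne', sub_self, mul_zero]

end
end

section
/- Fix α_u, α_v, ρ_u, ρ_v > 0 and define i(m_u,m_v,λ) = (λ α_u α_v/2)(ρ_u−m_u)(ρ_v−m_v) + (α_u/2) ln(1+λ α_v ρ_u m_v) + (α_v/2) ln(1+λ α_u ρ_v m_u). Let h(λ) = inf_{m_u∈[0,ρ_u]} sup_{m_v∈[0,ρ_v]} i(m_u,m_v,λ) and λ_IT = 1/(ρ_u ρ_v √(α_u α_v)). Define m_u*(λ) = m_v*(λ) = 0 for 0 < λ ≤ λ_IT and m_u*(λ) = (λ² α_u α_v ρ_v² ρ_u² − 1)/(λ α_u ρ_v (1 + λ α_v ρ_v ρ_u)), m_v*(λ)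 = (λ² α_u α_v ρ_v² ρ_u² − 1)/(λ α_v ρ_u (1 + λ α_u ρ_v ρ_u)) for λ > λ_IT. Then h is continuously differentiable on (0,∞), h(λ) = i(m_u*(λ), m_v*(λ), λ) for all λ > 0, and h'(λ) = (α_u α_v/2)(ρ_u ρ_v − m_u*(λ) m_v*(λ)) for all λ > 0. -/
open Real Set

noncomputable section

/-- `h(λ) = inf_{m_u ∈ [0,ρ_u]} sup_{m_v ∈ [0,ρ_v]} i(m_u,m_v,λ)`. -/
def hFun (au av ru rv lam : ℝ) : ℝ :=
  sInf ((fun mu => sSup ((fun mv => rsPotential au av ru rv mu mv lam) ''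
    Icc (0:ℝ) rv)) '' Icc (0:ℝ) ru)

/-- `m_u^*(λ)`. -/
def muStar (au av ru rv lam : ℝ) : ℝ :=
  if lam ≤ 1 / (ru * rv * Real.sqrt (au * av)) then 0
  else (lam ^ 2 * au * av * rv ^ 2 * ru ^ 2 - 1) / (lam * au * rv * (1 + lam * av * rv * ru))

/-- `m_v^*(λ)`. -/
def mvStar (au av ru rv lam : ℝ) : ℝ :=
  if lam ≤ 1 / (ru * rv * Real.sqrt (au * av)) then 0
  else (lam ^ 2 * au * av * rv ^ 2 * ru ^ 2 - 1) / (lam * av * ru * (1 + lam * au * rv * ru))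

/-- The value of `m_u^*` above the threshold; below it, the value is non-positive. -/
def muFormula (au av ru rv lam : ℝ) : ℝ :=
  (lam ^ 2 * au * av * rv ^ 2 * ru ^ 2 - 1) / (lam * au * rv * (1 + lam * av * rv * ru))

/-- The value of `m_v^*` above the threshold; below it, the value is non-positive. -/
def mvFormula (au av ru rv lam : ℝ) : ℝ :=
  (lam ^ 2 * au * av * rv ^ 2 * ru ^ 2 - 1) / (lam * av * ru * (1 + lam * au * rv * ru))

/-- The maximum of `i(m_u, ·, λ)` over the half line, as a function of `m_u < ρ_u`. -/
def innerMax (au av ru rv lam mu : ℝ) : ℝ :=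
  lam * au * av / 2 * (ru - mu) * rv - au / 2 * (mu / ru)
    + au / 2 * (Real.log ru - Real.log (ru - mu))
    + av / 2 * Real.log (1 + lam * au * rv * mu)

section

variable {au av ru rv lam : ℝ}

lemma le_threshold_iff (hau : 0 < au) (hav : 0 < av) (hru : 0 < ru) (hrv : 0 < rv)
    (hl : 0 < lam) :
    lam ≤ 1 / (ru * rv * Real.sqrt (au * av)) ↔
      lam ^ 2 * au * av * rv ^ 2 * ru ^ 2 - 1 ≤ 0 := by
  have hs : 0 < Real.sqrt (au * av) := Real.sqrt_pos.2 (by positivity)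
  have hsq : Real.sqrt (au * av) ^ 2 = au * av := Real.sq_sqrt (by positivity)
  have h : lam ^ 2 * au * av * rv ^ 2 * ru ^ 2 = (lam * (ru * rv * Real.sqrt (au * av))) ^ 2 := by
    rw [mul_pow, mul_pow, mul_pow, hsq]; ring
  rw [le_div_iff₀ (by positivity), h, sub_nonpos, sq_le_one_iff₀ (by positivity)]

lemma muStar_eq_max (hau : 0 < au) (hav : 0 < av) (hru : 0 < ru) (hrv : 0 < rv)
    (hl : 0 < lam) : muStar au av ru rv lam = max 0 (muFormula au av ru rv lam) := by
  have hd : 0 < lam * au * rv * (1 + lam * av * rv * ru) := by positivity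
  rw [muStar]
  split_ifs with h
  · rw [le_threshold_iff hau hav hru hrv hl] at h
    exact (max_eq_left (div_nonpos_of_nonpos_of_nonneg h hd.le)).symm
  · rw [le_threshold_iff hau hav hru hrv hl, not_le] at h
    exact (max_eq_right (div_nonneg h.le hd.le)).symm

lemma mvStar_eq_max (hau : 0 < au) (hav : 0 < av) (hru : 0 < ru) (hrv : 0 < rv)
    (hl : 0 < lam) : mvStar au av ru rv lam = max 0 (mvFormula au av ru rv lam) := by
  have hd : 0 < lam * av * ru * (1 + lam * au * rv * ru) := by positivity
  rw [mvStar]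
  split_ifs with h
  · rw [le_threshold_iff hau hav hru hrv hl] at h
    exact (max_eq_left (div_nonpos_of_nonpos_of_nonneg h hd.le)).symm
  · rw [le_threshold_iff hau hav hru hrv hl, not_le] at h
    exact (max_eq_right (div_nonneg h.le hd.le)).symm

lemma differentiableAt_muFormula (hau : 0 < au) (hav : 0 < av) (hru : 0 < ru) (hrv : 0 < rv)
    (hl : 0 < lam) : DifferentiableAt ℝ (muFormula au av ru rv) lam := by
  have hd : lam * au * rv * (1 + lam * av * rv * ru) ≠ 0 := by positivity
  unfold muFormula
  fun_prop (disch := exact hd)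

lemma differentiableAt_mvFormula (hau : 0 < au) (hav : 0 < av) (hru : 0 < ru) (hrv : 0 < rv)
    (hl : 0 < lam) : DifferentiableAt ℝ (mvFormula au av ru rv) lam := by
  have hd : lam * av * ru * (1 + lam * au * rv * ru) ≠ 0 := by positivity
  unfold mvFormula
  fun_prop (disch := exact hd)

lemma continuousOn_muStar (hau : 0 < au) (hav : 0 < av) (hru : 0 < ru) (hrv : 0 < rv) :
    ContinuousOn (muStar au av ru rv) (Ioi 0) :=
  ContinuousOn.congr
    (continuousOn_const.sup fun _ hl =>
      (differentiableAt_muFormula hau hav hru hrv hl).continuousAt.continuousWithinAt)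
    fun _ hl => muStar_eq_max hau hav hru hrv hl

lemma continuousOn_mvStar (hau : 0 < au) (hav : 0 < av) (hru : 0 < ru) (hrv : 0 < rv) :
    ContinuousOn (mvStar au av ru rv) (Ioi 0) :=
  ContinuousOn.congr
    (continuousOn_const.sup fun _ hl =>
      (differentiableAt_mvFormula hau hav hru hrv hl).continuousAt.continuousWithinAt)
    fun _ hl => mvStar_eq_max hau hav hru hrv hl

lemma muFormula_lt (hau : 0 < au) (hav : 0 < av) (hru : 0 < ru) (hrv : 0 < rv)
    (hl : 0 < lam) : muFormula au av ru rv lam < ru := by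
  have h : 0 < ru - muFormula au av ru rv lam := by
    have : ru - muFormula au av ru rv lam
        = (1 + lam * au * rv * ru) / (lam * au * rv * (1 + lam * av * rv * ru)) := by
      rw [muFormula]; field_simp; ring
    rw [this]; positivity
  linarith

lemma mvFormula_lt (hau : 0 < au) (hav : 0 < av) (hru : 0 < ru) (hrv : 0 < rv)
    (hl : 0 < lam) : mvFormula au av ru rv lam < rv := by
  have h : 0 < rv - mvFormula au av ru rv lam := by
    have : rv - mvFormula au av ru rv lam
        = (1 + lam * av * rv * ru) / (lam * av * ru * (1 + lam * au * rv * ru)) := by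
      rw [mvFormula]; field_simp; ring
    rw [this]; positivity
  linarith

lemma stationary_muFormula (hau : 0 < au) (hav : 0 < av) (hru : 0 < ru) (hrv : 0 < rv)
    (hl : 0 < lam) :
    (ru - muFormula au av ru rv lam) * (1 + lam * av * ru * mvFormula au av ru rv lam) = ru := by
  have hA : 1 + lam * av * rv * ru ≠ 0 := by positivity
  have hB : 1 + lam * au * rv * ru ≠ 0 := by positivity
  rw [muFormula, mvFormula]; field_simp; ring

lemma stationary_mvFormula (hau : 0 < au) (hav : 0 < av) (hru : 0 < ru) (hrv : 0 < rv)
    (hl : 0 < lam) :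
    (rv - mvFormula au av ru rv lam) * (1 + lam * au * rv * muFormula au av ru rv lam) = rv := by
  have hA : 1 + lam * av * rv * ru ≠ 0 := by positivity
  have hB : 1 + lam * au * rv * ru ≠ 0 := by positivity
  rw [muFormula, mvFormula]; field_simp; ring

/-- The optimal pair is either zero or given by the formulas. -/
lemma star_eq_zero_or (au av ru rv lam : ℝ) :
    (muStar au av ru rv lam = 0 ∧ mvStar au av ru rv lam = 0) ∨
      (muStar au av ru rv lam = muFormula au av ru rv lam ∧
        mvStar au av ru rv lam = mvFormula au av ru rv lam) := by
  unfold muStar mvStar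
  split_ifs
  · exact Or.inl ⟨rfl, rfl⟩
  · exact Or.inr ⟨rfl, rfl⟩

lemma stationary_muStar (hau : 0 < au) (hav : 0 < av) (hru : 0 < ru) (hrv : 0 < rv)
    (hl : 0 < lam) :
    (ru - muStar au av ru rv lam) * (1 + lam * av * ru * mvStar au av ru rv lam) = ru := by
  rcases star_eq_zero_or au av ru rv lam with ⟨h₁, h₂⟩ | ⟨h₁, h₂⟩ <;> rw [h₁, h₂]
  · ring
  · exact stationary_muFormula hau hav hru hrv hl

/-- `i(m_u, ·, λ)` is maximal at any of its critical points. -/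
lemma rsPotential_le_of_stationary (hau : 0 < au) (hav : 0 < av) (hru : 0 < ru)
    (hl : 0 < lam) {mu mv y : ℝ} (hmv : 0 ≤ mv) (hy : 0 ≤ y)
    (h : (ru - mu) * (1 + lam * av * ru * mv) = ru) :
    rsPotential au av ru rv mu y lam ≤ rsPotential au av ru rv mu mv lam := by
  have hp : 0 < 1 + lam * av * ru * mv := by positivity
  have hq : 0 < 1 + lam * av * ru * y := by positivity
  have hlog := Real.log_le_sub_one_of_pos (div_pos hq hp)
  rw [Real.log_div hq.ne' hp.ne'] at hlog
  have he : (1 + lam * av * ru * y) / (1 + lam * av * ru * mv) - 1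
      = lam * av * (ru - mu) * (y - mv) := by
    rw [div_sub_one hp.ne', div_eq_iff hp.ne']
    linear_combination (-(lam * av * (y - mv))) * h
  rw [he] at hlog
  have := mul_le_mul_of_nonneg_left hlog hau.le
  unfold rsPotential
  linarith

/-- At a critical point of `i(m_u, ·, λ)`, the potential equals `innerMax`. -/
lemma rsPotential_eq_innerMax (hav : 0 < av) (hru : 0 < ru) (hl : 0 < lam) {mu mv : ℝ}
    (hmv : 0 ≤ mv) (h : (ru - mu) * (1 + lam * av * ru * mv) = ru) :
    rsPotential au av ru rv mu mv lam = innerMax au av ru rv lam mu := by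
  have hp : 0 < 1 + lam * av * ru * mv := by positivity
  have hmu : 0 < ru - mu := pos_of_mul_pos_left (by rw [h]; exact hru) hp.le
  have hlog := Real.log_mul hmu.ne' hp.ne'
  rw [h] at hlog
  have hx : mu / ru = lam * av * (ru - mu) * mv := by
    rw [div_eq_iff hru.ne']
    linear_combination -h
  rw [rsPotential, innerMax, hx, hlog]
  ring

lemma hasDerivAt_innerMax (hau : 0 < au) (hru : 0 < ru) (hrv : 0 < rv) (hav : 0 < av)
    (hl : 0 < lam) {mu : ℝ} (h₀ : 0 ≤ mu) (h₁ : mu < ru) :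
    HasDerivAt (innerMax au av ru rv lam)
      (au / 2 * (mu / (ru * (ru - mu) * (1 + lam * au * rv * mu)) *
        (lam * au * rv * (1 + lam * av * rv * ru))) * (mu - muFormula au av ru rv lam)) mu := by
  have hs : ru - mu ≠ 0 := (sub_pos.2 h₁).ne'
  have hp : 1 + lam * au * rv * mu ≠ 0 := by positivity
  have hA : 1 + lam * av * rv * ru ≠ 0 := by positivity
  have hid := hasDerivAt_id' mu
  have d₁ := ((hid.const_sub ru).const_mul (lam * au * av / 2)).mul_const rv
  have d₂ := (hid.div_const ru).const_mul (au / 2)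
  have d₃ := (((hid.const_sub ru).log hs).const_sub (Real.log ru)).const_mul (au / 2)
  have d₄ := (((hid.const_mul (lam * au * rv)).const_add 1).log hp).const_mul (av / 2)
  refine (((d₁.sub d₂).add d₃).add d₄).congr_deriv ?_
  rw [muFormula]
  field_simp
  ring

/-- `innerMax` is minimal at `m_u^*`. -/
lemma innerMax_muStar_le (hau : 0 < au) (hav : 0 < av) (hru : 0 < ru) (hrv : 0 < rv)
    (hl : 0 < lam) {mu : ℝ} (h₀ : 0 ≤ mu) (h₁ : mu < ru) :
    innerMax au av ru rv lam (muStar au av ru rv lam) ≤ innerMax au av ru rv lam mu := by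
  have hm := muStar_eq_max hau hav hru hrv hl
  set m := muStar au av ru rv lam
  have hm0 : 0 ≤ m := hm ▸ le_max_left _ _
  have hm1 : m < ru := by
    rw [hm]
    exact max_lt hru (muFormula_lt hau hav hru hrv hl)
  have hd := fun x (hx0 : 0 ≤ x) (hx1 : x < ru) =>
    hasDerivAt_innerMax hau hru hrv hav hl hx0 hx1
  have hw : ∀ x, 0 ≤ x → x < ru →
      0 ≤ au / 2 * (x / (ru * (ru - x) * (1 + lam * au * rv * x)) *
        (lam * au * rv * (1 + lam * av * rv * ru))) := by
    intro x hx0 hx1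
    have := sub_pos.2 hx1
    positivity
  rcases le_total m mu with h | h
  · refine monotoneOn_of_hasDerivWithinAt_nonneg (convex_Icc m mu)
      (fun x hx => (hd x (hm0.trans hx.1) (hx.2.trans_lt h₁)).continuousAt.continuousWithinAt)
      (fun x hx => (hd x (hm0.trans (interior_subset hx).1)
        ((interior_subset hx).2.trans_lt h₁)).hasDerivWithinAt)
      (fun x hx => ?_) (left_mem_Icc.2 h) (right_mem_Icc.2 h) h
    have hx := interior_subset hx
    exact mul_nonneg (hw x (hm0.trans hx.1) (hx.2.trans_lt h₁))
      (sub_nonneg.2 ((le_max_right _ _).trans (hm ▸ hx.1)))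
  · refine antitoneOn_of_hasDerivWithinAt_nonpos (convex_Icc mu m)
      (fun x hx => (hd x (h₀.trans hx.1) (hx.2.trans_lt hm1)).continuousAt.continuousWithinAt)
      (fun x hx => (hd x (h₀.trans (interior_subset hx).1)
        ((interior_subset hx).2.trans_lt hm1)).hasDerivWithinAt)
      (fun x hx => ?_) (left_mem_Icc.2 h) (right_mem_Icc.2 h) h
    rw [interior_Icc] at hx
    have hx0 := h₀.trans_lt hx.1
    refine mul_nonpos_of_nonneg_of_nonpos (hw x hx0.le (hx.2.trans hm1)) (sub_nonpos.2 ?_)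
    exact (((lt_max_iff.1 (hm ▸ hx.2)).resolve_left hx0.not_gt)).le

lemma exists_rsPotential_ge (hau : 0 < au) (hav : 0 < av) (hru : 0 < ru) (hrv : 0 < rv)
    (hl : 0 < lam) {mu : ℝ} (hmu : mu ∈ Icc 0 ru) :
    ∃ mv ∈ Icc 0 rv, innerMax au av ru rv lam (muStar au av ru rv lam)
      ≤ rsPotential au av ru rv mu mv lam := by
  set c := lam * av * rv * ru / (1 + lam * av * rv * ru) * ru with hc
  have hA : 0 < 1 + lam * av * rv * ru := by positivity
  have hc0 : 0 ≤ c := by positivity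
  have hc1 : ru - c = ru / (1 + lam * av * rv * ru) := by rw [hc]; field_simp; ring
  have hcr : c < ru := by
    have : 0 < ru - c := by rw [hc1]; positivity
    linarith
  rcases le_total mu c with h | h
  · have hs : 0 < ru - mu := by linarith
    have hmu0 := hmu.1
    refine ⟨mu / (lam * av * ru * (ru - mu)), ⟨by positivity, ?_⟩, ?_⟩
    · rw [div_le_iff₀ (by positivity)]
      have : mu * (1 + lam * av * rv * ru) ≤ c * (1 + lam * av * rv * ru) := by gcongr
      have hce : c * (1 + lam * av * rv * ru) = lam * av * rv * ru * ru := by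
        rw [hc]; field_simp
      linarith
    · rw [rsPotential_eq_innerMax hav hru hl (by positivity) (by field_simp; ring)]
      exact innerMax_muStar_le hau hav hru hrv hl hmu0 (by linarith)
  · refine ⟨rv, right_mem_Icc.2 hrv.le, ?_⟩
    calc innerMax au av ru rv lam (muStar au av ru rv lam)
        ≤ innerMax au av ru rv lam c := innerMax_muStar_le hau hav hru hrv hl hc0 hcr
      _ = rsPotential au av ru rv c rv lam :=
        (rsPotential_eq_innerMax hav hru hl hrv.le (by rw [hc1]; field_simp)).symm
      _ ≤ rsPotential au av ru rv mu rv lam := by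
        unfold rsPotential
        simp only [sub_self, mul_zero, zero_add]
        gcongr

lemma continuousOn_rsPotential_right (hav : 0 < av) (hru : 0 < ru) (hl : 0 < lam) (mu : ℝ) :
    ContinuousOn (fun mv => rsPotential au av ru rv mu mv lam) (Icc 0 rv) := by
  unfold rsPotential
  have h : ∀ x ∈ Icc 0 rv, 1 + lam * av * ru * x ≠ 0 := by
    intro x hx
    have := hx.1
    positivity
  fun_prop (disch := assumption)

lemma mvStar_mem (hau : 0 < au) (hav : 0 < av) (hru : 0 < ru) (hrv : 0 < rv)
    (hl : 0 < lam) : mvStar au av ru rv lam ∈ Icc 0 rv := by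
  rw [mvStar_eq_max hau hav hru hrv hl]
  exact ⟨le_max_left _ _, max_le hrv.le (mvFormula_lt hau hav hru hrv hl).le⟩

lemma muStar_mem (hau : 0 < au) (hav : 0 < av) (hru : 0 < ru) (hrv : 0 < rv)
    (hl : 0 < lam) : muStar au av ru rv lam ∈ Icc 0 ru := by
  rw [muStar_eq_max hau hav hru hrv hl]
  exact ⟨le_max_left _ _, max_le hru.le (muFormula_lt hau hav hru hrv hl).le⟩

lemma hFun_eq (hau : 0 < au) (hav : 0 < av) (hru : 0 < ru) (hrv : 0 < rv) (hl : 0 < lam) :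
    hFun au av ru rv lam
      = rsPotential au av ru rv (muStar au av ru rv lam) (mvStar au av ru rv lam) lam := by
  have hv := mvStar_mem hau hav hru hrv hl
  have hst := stationary_muStar hau hav hru hrv hl
  refine IsLeast.csInf_eq ⟨⟨_, muStar_mem hau hav hru hrv hl, IsGreatest.csSup_eq
    ⟨mem_image_of_mem _ hv, ?_⟩⟩, ?_⟩
  · rintro _ ⟨y, hy, rfl⟩
    exact rsPotential_le_of_stationary hau hav hru hl hv.1 hy.1 hst
  · rintro _ ⟨mu, hmu, rfl⟩
    obtain ⟨mv, hmv, hle⟩ := exists_rsPotential_ge hau hav hru hrv hl hmu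
    rw [rsPotential_eq_innerMax hav hru hl hv.1 hst]
    exact hle.trans (le_csSup
      (isCompact_Icc.bddAbove_image (continuousOn_rsPotential_right hav hru hl mu))
      (mem_image_of_mem _ hmv))

lemma continuousOn_hFun (hau : 0 < au) (hav : 0 < av) (hru : 0 < ru) (hrv : 0 < rv) :
    ContinuousOn (hFun au av ru rv) (Ioi 0) := by
  refine ContinuousOn.congr ?_ fun _ hl => hFun_eq hau hav hru hrv hl
  have hu := continuousOn_muStar hau hav hru hrv
  have hv := continuousOn_mvStar hau hav hru hrv
  have h₁ : ∀ x ∈ Ioi (0 : ℝ), 1 + x * av * ru * mvStar au av ru rv x ≠ 0 := by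
    intro x hx
    have hx : 0 < x := hx
    have := (mvStar_mem hau hav hru hrv hx).1
    positivity
  have h₂ : ∀ x ∈ Ioi (0 : ℝ), 1 + x * au * rv * muStar au av ru rv x ≠ 0 := by
    intro x hx
    have hx : 0 < x := hx
    have := (muStar_mem hau hav hru hrv hx).1
    positivity
  unfold rsPotential
  fun_prop (disch := assumption)

/-- Envelope formula: along a differentiable curve which is critical at `λ`, only the explicit
dependence on `λ` contributes to the derivative of the potential. -/
lemma hasDerivAt_rsPotential_of_stationary (hru : 0 < ru) (hrv : 0 < rv) {f g : ℝ → ℝ}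
    (hf : DifferentiableAt ℝ f lam) (hg : DifferentiableAt ℝ g lam)
    (hfs : (ru - f lam) * (1 + lam * av * ru * g lam) = ru)
    (hgs : (rv - g lam) * (1 + lam * au * rv * f lam) = rv) :
    HasDerivAt (fun x => rsPotential au av ru rv (f x) (g x) x)
      (au * av / 2 * (ru * rv - f lam * g lam)) lam := by
  have hp : 1 + lam * av * ru * g lam ≠ 0 := right_ne_zero_of_mul (hfs.trans_ne hru.ne')
  have hq : 1 + lam * au * rv * f lam ≠ 0 := right_ne_zero_of_mul (hgs.trans_ne hrv.ne')
  have hp' := eq_div_of_mul_eq hp hfs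
  have hq' := eq_div_of_mul_eq hq hgs
  have hid := hasDerivAt_id' lam
  have df := hf.hasDerivAt
  have dg := hg.hasDerivAt
  have d₁ := ((((hid.mul_const au).mul_const av).div_const 2).mul (df.const_sub ru)).mul
    (dg.const_sub rv)
  have d₂ := ((((((hid.mul_const av).mul_const ru).mul dg).const_add 1).log hp).const_mul
    au).div_const 2
  have d₃ := ((((((hid.mul_const au).mul_const rv).mul df).const_add 1).log hq).const_mul
    av).div_const 2
  refine ((d₁.add d₂).add d₃).congr_deriv ?_
  have e₁ : (1 * av * ru * g lam + lam * av * ru * deriv g lam) / (1 + lam * av * ru * g lam)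
      = av * (g lam + lam * deriv g lam) * (ru - f lam) := by rw [hp']; ring
  have e₂ : (1 * au * rv * f lam + lam * au * rv * deriv f lam) / (1 + lam * au * rv * f lam)
      = au * (f lam + lam * deriv f lam) * (rv - g lam) := by rw [hq']; ring
  simp only [Pi.mul_apply]
  rw [e₁, e₂]
  ring

lemma hasDerivAt_hFun_of_ne (hau : 0 < au) (hav : 0 < av) (hru : 0 < ru) (hrv : 0 < rv)
    (hl : 0 < lam) (hne : lam ≠ 1 / (ru * rv * Real.sqrt (au * av))) :
    HasDerivAt (hFun au av ru rv)
      (au * av / 2 * (ru * rv - muStar au av ru rv lam * mvStar au av ru rv lam)) lam := by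
  rcases lt_or_gt_of_ne hne with h | h
  · have hd := hasDerivAt_rsPotential_of_stationary (au := au) (av := av) (lam := lam) hru hrv
      (differentiableAt_const (0 : ℝ)) (differentiableAt_const (0 : ℝ)) (by ring) (by ring)
    rw [muStar, mvStar, if_pos h.le, if_pos h.le]
    refine hd.congr_of_eventuallyEq ?_
    filter_upwards [lt_mem_nhds hl, gt_mem_nhds h] with x hx hxt
    rw [hFun_eq hau hav hru hrv hx, muStar, mvStar, if_pos hxt.le, if_pos hxt.le]
  · have hd := hasDerivAt_rsPotential_of_stationary hru hrv
      (differentiableAt_muFormula hau hav hru hrv hl)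
      (differentiableAt_mvFormula hau hav hru hrv hl)
      (stationary_muFormula hau hav hru hrv hl) (stationary_mvFormula hau hav hru hrv hl)
    rw [muStar, mvStar, if_neg h.not_ge, if_neg h.not_ge]
    refine hd.congr_of_eventuallyEq ?_
    filter_upwards [lt_mem_nhds hl, lt_mem_nhds h] with x hx hxt
    rw [hFun_eq hau hav hru hrv hx, muStar, mvStar, if_neg hxt.not_ge, if_neg hxt.not_ge]
    rfl

lemma continuousOn_derivFormula (hau : 0 < au) (hav : 0 < av) (hru : 0 < ru) (hrv : 0 < rv) :
    ContinuousOn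
      (fun lam => au * av / 2 * (ru * rv - muStar au av ru rv lam * mvStar au av ru rv lam))
      (Ioi (0:ℝ)) :=
  continuousOn_const.mul (continuousOn_const.sub
    ((continuousOn_muStar hau hav hru hrv).mul (continuousOn_mvStar hau hav hru hrv)))

lemma hasDerivAt_hFun (hau : 0 < au) (hav : 0 < av) (hru : 0 < ru) (hrv : 0 < rv)
    (hl : 0 < lam) :
    HasDerivAt (hFun au av ru rv)
      (au * av / 2 * (ru * rv - muStar au av ru rv lam * mvStar au av ru rv lam)) lam := by
  rcases ne_or_eq lam (1 / (ru * rv * Real.sqrt (au * av))) with hne | heq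
  · exact hasDerivAt_hFun_of_ne hau hav hru hrv hl hne
  have hd : ∀ x ∈ Ioi (0 : ℝ), x ≠ lam → HasDerivAt (hFun au av ru rv)
      (au * av / 2 * (ru * rv - muStar au av ru rv x * mvStar au av ru rv x)) x :=
    fun x hx hxl => hasDerivAt_hFun_of_ne hau hav hru hrv hx (heq ▸ hxl)
  have hs : Ioi (0 : ℝ) ∈ nhds lam := Ioi_mem_nhds hl
  have hf := (continuousOn_hFun hau hav hru hrv).continuousAt hs
  have hg := (continuousOn_derivFormula hau hav hru hrv).continuousAt hs
  have hright := hasDerivWithinAt_Ici_of_tendsto_deriv (s := Ioi lam)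
    (e := au * av / 2 * (ru * rv - muStar au av ru rv lam * mvStar au av ru rv lam))
    (fun x hx => (hd x (hl.trans hx) (ne_of_gt hx)).differentiableAt.differentiableWithinAt)
    hf.continuousWithinAt self_mem_nhdsWithin
    ((hg.mono_left nhdsWithin_le_nhds).congr' (by
      filter_upwards [self_mem_nhdsWithin] with x hx
      exact (hd x (hl.trans hx) (ne_of_gt hx)).deriv.symm))
  have hleft := hasDerivWithinAt_Iic_of_tendsto_deriv (s := Ioo 0 lam)
    (e := au * av / 2 * (ru * rv - muStar au av ru rv lam * mvStar au av ru rv lam))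
    (fun x hx => (hd x hx.1 hx.2.ne).differentiableAt.differentiableWithinAt)
    hf.continuousWithinAt (Ioo_mem_nhdsLT hl)
    ((hg.mono_left nhdsWithin_le_nhds).congr' (by
      filter_upwards [Ioo_mem_nhdsLT hl] with x hx
      exact (hd x hx.1 hx.2.ne).deriv.symm))
  simpa using hleft.union hright

end

/-- **properties of `h`.** With `α_u, α_v, ρ_u, ρ_v > 0` fixed, the
function `h(λ) = inf_{m_u} sup_{m_v} i(m_u,m_v,λ)` satisfies
`h(λ) = i(m_u^*(λ), m_v^*(λ), λ)` for all `λ > 0`, it is differentiable on `(0,∞)`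
with `h'(λ) = (α_uα_v/2)(ρ_uρ_v − m_u^*(λ)m_v^*(λ))`, and this derivative is a
continuous function of `λ` on `(0,∞)` (so `h` is continuously differentiable). -/
theorem hFun_continuously_differentiable
    (au av ru rv : ℝ) (hau : 0 < au) (hav : 0 < av) (hru : 0 < ru) (hrv : 0 < rv) :
    (∀ lam : ℝ, 0 < lam →
      hFun au av ru rv lam
        = rsPotential au av ru rv (muStar au av ru rv lam) (mvStar au av ru rv lam) lam) ∧
    (∀ lam : ℝ, 0 < lam →
      HasDerivAt (hFun au av ru rv)
        (au * av / 2 * (ru * rv - muStar au av ru rv lam * mvStar au av ru rv lam)) lam) ∧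
    ContinuousOn
      (fun lam => au * av / 2 * (ru * rv - muStar au av ru rv lam * mvStar au av ru rv lam))
      (Ioi (0:ℝ)) := by
  exact ⟨fun _ hl => hFun_eq hau hav hru hrv hl,
    fun _ hl => hasDerivAt_hFun hau hav hru hrv hl,
    continuousOn_derivFormula hau hav hru hrv⟩

end
end
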